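/- Let σ1², σ2² > 0, x1, x2 ∈ ℝ^p, r = σ2²/σ1², and let A ⊆ ℝ^p be measurable with P(N_p(x1 − x2, (σ1²+σ2²) I_p) ∈ A) > 0. Let (θ1, θ2) be distributed on ℝ^{2p} with density proportional to exp(−‖θ1 − x1‖²/(2σ1²)) · exp(−‖θ2 − x2‖²/(2σ2²)) · 1_A(θ1 − θ2) (the posterior for the uniform prior 1_A(θ1 − θ2)). Then ω1 = θ1 − θ2 and ω2 = rθ1 + θ2 are independent; ω2 ~ N_p( r x1 + x2, (1+r)σ2² I_p ); and ω1 is distributed as N_p( x1 − x2, (σ1²+σ2²) I_p ) conditioned on lying in A. Moreover E(θ1) = ( E(ω1) + r x1 + x2 )/(1+r). -/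

import Mathlib

open MeasureTheory Real Set
open scoped ENNReal

noncomputable section

abbrev Ep (p : ℕ) := EuclideanSpace ℝ (Fin p)

/-- Density of `N_p(0, v I_p)` evaluated at `u`. -/
def gdens (p : ℕ) (v : ℝ) (u : Ep p) : ℝ :=
  (2 * Real.pi * v) ^ (-(p : ℝ) / 2) * Real.exp (-‖u‖ ^ 2 / (2 * v))

/-- Unnormalized posterior density for the uniform prior `1_A(θ1 - θ2)`. -/
def postDens (p : ℕ) (σ12 σ22 : ℝ) (x1 x2 : Ep p) (A : Set (Ep p))
    (θ : Ep p × Ep p) : ℝ≥0∞ :=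
  ENNReal.ofReal (gdens p σ12 (θ.1 - x1) * gdens p σ22 (θ.2 - x2) *
    Set.indicator A (fun _ => (1 : ℝ)) (θ.1 - θ.2))

lemma gdens_norm_const_pos (p : ℕ) {v : ℝ} (hv : 0 < v) :
    0 < (2 * Real.pi * v) ^ (-(p : ℝ) / 2) := by positivity

lemma gdens_pos (p : ℕ) {v : ℝ} (hv : 0 < v) (u : Ep p) : 0 < gdens p v u :=
  mul_pos (gdens_norm_const_pos p hv) (Real.exp_pos _)

lemma gdens_neg (p : ℕ) (v : ℝ) (u : Ep p) : gdens p v (-u) = gdens p v u := by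
  simp [gdens]

lemma continuous_gdens (p : ℕ) (v : ℝ) : Continuous (gdens p v) := by
  unfold gdens; fun_prop

lemma integral_gdens (p : ℕ) {v : ℝ} (hv : 0 < v) : ∫ u, gdens p v u = 1 := by
  have h := GaussianFourier.integral_rexp_neg_mul_sq_norm (V := Ep p)
    (b := (2 * v)⁻¹) (by positivity)
  have h2 : ∀ u : Ep p, gdens p v u =
      (2 * Real.pi * v) ^ (-(p : ℝ) / 2) * Real.exp (-(2 * v)⁻¹ * ‖u‖ ^ 2) := by
    intro u
    simp only [gdens]
    congr 2
    field_simp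
  simp_rw [h2]
  rw [integral_const_mul, h, finrank_euclideanSpace_fin,
    show Real.pi / (2 * v)⁻¹ = 2 * Real.pi * v by field_simp, neg_div,
    Real.rpow_neg (by positivity), inv_mul_cancel₀ (by positivity)]

lemma integrable_gdens (p : ℕ) {v : ℝ} (hv : 0 < v) : Integrable (gdens p v) :=
  .of_integral_ne_zero (by rw [integral_gdens p hv]; exact one_ne_zero)

lemma norm_mul_exp_neg_sq_le {v : ℝ} (hv : 0 < v) (t : ℝ) :
    t * Real.exp (-t ^ 2 / (2 * v)) ≤ (1 + 4 * v) * Real.exp (-t ^ 2 / (2 * (2 * v))) := by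
  have h1 : Real.exp (-t ^ 2 / (2 * (2 * v))) =
      Real.exp (t ^ 2 / (4 * v)) * Real.exp (-t ^ 2 / (2 * v)) := by
    rw [← Real.exp_add]
    congr 1
    field_simp
    ring
  rw [h1, ← mul_assoc]
  gcongr
  have h2 := Real.add_one_le_exp (t ^ 2 / (4 * v))
  calc t ≤ 1 + t ^ 2 := by nlinarith [sq_nonneg (t - 1)]
    _ ≤ (1 + 4 * v) * (t ^ 2 / (4 * v) + 1) := by
      have h3 : 4 * v * (t ^ 2 / (4 * v)) = t ^ 2 := by field_simp
      have h4 : 0 ≤ t ^ 2 / (4 * v) := by positivity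
      nlinarith
    _ ≤ _ := by gcongr

lemma integrable_gdens_smul (p : ℕ) {v : ℝ} (hv : 0 < v) :
    Integrable (fun u : Ep p => gdens p v u • u) := by
  have h2v : 0 < 2 * v := by positivity
  refine ((integrable_gdens p h2v).const_mul
    ((2 * Real.pi * v) ^ (-(p : ℝ) / 2) * ((1 + 4 * v) *
      ((2 * Real.pi * (2 * v)) ^ (-(p : ℝ) / 2))⁻¹))).mono'
    ((continuous_gdens p v).smul continuous_id).aestronglyMeasurable (ae_of_all _ fun u => ?_)
  rw [norm_smul, Real.norm_of_nonneg (gdens_pos p hv u).le]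
  have h := mul_le_mul_of_nonneg_left (norm_mul_exp_neg_sq_le hv ‖u‖)
    (gdens_norm_const_pos p hv).le
  have hc := (gdens_norm_const_pos p h2v).ne'
  calc gdens p v u * ‖u‖ = (2 * Real.pi * v) ^ (-(p : ℝ) / 2) *
        (‖u‖ * Real.exp (-‖u‖ ^ 2 / (2 * v))) := by unfold gdens; ring
    _ ≤ _ := h
    _ = _ := by
      unfold gdens
      field_simp

/-- The measure `N_p(m, v I_p)`. -/
def gaussMeasure (p : ℕ) (v : ℝ) (m : Ep p) : Measure (Ep p) :=
  volume.withDensity (fun w => ENNReal.ofReal (gdens p v (w - m)))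

lemma measurable_ofReal_gdens_sub (p : ℕ) (v : ℝ) (m : Ep p) :
    Measurable (fun w => ENNReal.ofReal (gdens p v (w - m))) :=
  ((continuous_gdens p v).comp (continuous_id.sub continuous_const)).measurable.ennreal_ofReal

lemma isProbabilityMeasure_gaussMeasure (p : ℕ) {v : ℝ} (hv : 0 < v) (m : Ep p) :
    IsProbabilityMeasure (gaussMeasure p v m) := by
  constructor
  rw [gaussMeasure, withDensity_apply _ MeasurableSet.univ, Measure.restrict_univ,
    ← ofReal_integral_eq_lintegral_ofReal ((integrable_gdens p hv).comp_sub_right m)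
      (ae_of_all _ fun w => (gdens_pos p hv _).le),
    integral_sub_right_eq_self (gdens p v) m, integral_gdens p hv, ENNReal.ofReal_one]

lemma integrable_id_gaussMeasure (p : ℕ) {v : ℝ} (hv : 0 < v) (m : Ep p) :
    Integrable (fun w => w) (gaussMeasure p v m) := by
  rw [gaussMeasure, integrable_withDensity_iff_integrable_smul'
    (measurable_ofReal_gdens_sub p v m) (ae_of_all _ fun _ => ENNReal.ofReal_lt_top)]
  refine (((integrable_gdens_smul p hv).comp_sub_right m).add
    (((integrable_gdens p hv).comp_sub_right m).smul_const m)).congr (ae_of_all _ fun w => ?_)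
  simp only [Pi.add_apply]
  rw [ENNReal.toReal_ofReal (gdens_pos p hv _).le, ← smul_add, sub_add_cancel]

lemma integral_gdens_smul (p : ℕ) (v : ℝ) : ∫ u : Ep p, gdens p v u • u = 0 := by
  have h := integral_neg_eq_self (fun u : Ep p => gdens p v u • u) volume
  simp only [gdens_neg, smul_neg, integral_neg] at h
  have h2 := eq_neg_iff_add_eq_zero.mp h.symm
  rw [← two_smul ℝ] at h2
  exact (smul_eq_zero.mp h2).resolve_left two_ne_zero

lemma integral_id_gaussMeasure (p : ℕ) {v : ℝ} (hv : 0 < v) (m : Ep p) :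
    ∫ w, w ∂(gaussMeasure p v m) = m := by
  rw [gaussMeasure, integral_withDensity_eq_integral_toReal_smul
    (measurable_ofReal_gdens_sub p v m) (ae_of_all _ fun _ => ENNReal.ofReal_lt_top)]
  have h : ∀ w : Ep p, (ENNReal.ofReal (gdens p v (w - m))).toReal • w =
      gdens p v (w - m) • (w - m) + gdens p v (w - m) • m := by
    intro w
    rw [ENNReal.toReal_ofReal (gdens_pos p hv _).le, ← smul_add, sub_add_cancel]
  simp_rw [h]
  rw [integral_add ((integrable_gdens_smul p hv).comp_sub_right m)
    (((integrable_gdens p hv).comp_sub_right m).smul_const m),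
    integral_sub_right_eq_self (fun u : Ep p => gdens p v u • u) m,
    integral_sub_right_eq_self (fun u : Ep p => gdens p v u • m) m,
    integral_smul_const, integral_gdens p hv, integral_gdens_smul, zero_add, one_smul]

lemma norm_sq_div_add_norm_sq_div (p : ℕ) {s t : ℝ} (hs : 0 < s) (ht : 0 < t) (u v : Ep p) :
    -‖u‖ ^ 2 / (2 * s) + -‖v‖ ^ 2 / (2 * t) =
      -‖u - v‖ ^ 2 / (2 * (s + t)) + -‖(t / s) • u + v‖ ^ 2 / (2 * ((1 + t / s) * t)) := by
  rw [norm_sub_sq_real, norm_add_sq_real, norm_smul, real_inner_smul_left,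
    Real.norm_of_nonneg (by positivity)]
  field_simp
  ring

lemma exists_gdens_mul_gdens_eq (p : ℕ) {s t : ℝ} (hs : 0 < s) (ht : 0 < t) :
    ∃ K : ℝ, 0 < K ∧ ∀ u v : Ep p, gdens p s u * gdens p t v =
      K * (gdens p (s + t) (u - v) * gdens p ((1 + t / s) * t) ((t / s) • u + v)) := by
  have h1 := gdens_norm_const_pos p hs
  have h2 := gdens_norm_const_pos p ht
  have h3 := gdens_norm_const_pos p (add_pos hs ht)
  have h4 := gdens_norm_const_pos p (show 0 < (1 + t / s) * t by positivity)
  refine ⟨_, div_pos (mul_pos h1 h2) (mul_pos h3 h4), fun u v => ?_⟩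
  have h := congrArg Real.exp (norm_sq_div_add_norm_sq_div p hs ht u v)
  rw [Real.exp_add, Real.exp_add] at h
  unfold gdens
  generalize (2 * Real.pi * s) ^ (-(p : ℝ) / 2) = a at *
  generalize (2 * Real.pi * t) ^ (-(p : ℝ) / 2) = b at *
  generalize (2 * Real.pi * (s + t)) ^ (-(p : ℝ) / 2) = c at *
  generalize (2 * Real.pi * ((1 + t / s) * t)) ^ (-(p : ℝ) / 2) = d at *
  rw [mul_mul_mul_comm, h, mul_mul_mul_comm c, ← mul_assoc (a * b / (c * d)),
    div_mul_cancel₀ _ (mul_pos h3 h4).ne']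

/-- The change of variables `(θ1, θ2) ↦ (θ1 - θ2, r θ1 + θ2)`. -/
def diffCombEquiv (p : ℕ) {r : ℝ} (hr : 1 + r ≠ 0) : (Ep p × Ep p) ≃ₗ[ℝ] (Ep p × Ep p) where
  toFun θ := (θ.1 - θ.2, r • θ.1 + θ.2)
  invFun ω := ((1 + r)⁻¹ • (ω.1 + ω.2), (1 + r)⁻¹ • (ω.2 - r • ω.1))
  map_add' x y := by
    ext1 <;> simp only [Prod.fst_add, Prod.snd_add, smul_add] <;> abel
  map_smul' c x := by
    ext1 <;> simp only [Prod.smul_fst, Prod.smul_snd, smul_add, smul_sub, RingHom.id_apply,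
      smul_comm c r]
  left_inv θ := by
    ext1
    · simp only
      rw [inv_smul_eq_iff₀ hr]
      module
    · simp only
      rw [inv_smul_eq_iff₀ hr]
      module
  right_inv ω := by
    ext1
    · simp only
      rw [← smul_sub, inv_smul_eq_iff₀ hr]
      module
    · simp only
      rw [smul_comm, ← smul_add, inv_smul_eq_iff₀ hr]
      module

lemma map_withDensity_comp {α β : Type*} [MeasurableSpace α] [MeasurableSpace β]
    {μ : Measure α} {T : α → β} (hT : Measurable T) {f : β → ℝ≥0∞} (hf : Measurable f) :
    (μ.withDensity (fun x => f (T x))).map T = (μ.map T).withDensity f := by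
  ext s hs
  rw [Measure.map_apply hT hs, withDensity_apply _ (hT hs), withDensity_apply _ hs,
    setLIntegral_map hs hf hT]

lemma exists_map_diffComb_volume (p : ℕ) {r : ℝ} (hr : 1 + r ≠ 0) :
    ∃ c : ℝ≥0∞, c ≠ 0 ∧ c ≠ ∞ ∧
      (volume : Measure (Ep p × Ep p)).map (fun θ => (θ.1 - θ.2, r • θ.1 + θ.2)) =
        c • volume := by
  have hdet : LinearMap.det (diffCombEquiv p hr : (Ep p × Ep p) →ₗ[ℝ] (Ep p × Ep p)) ≠ 0 :=
    (LinearEquiv.isUnit_det' _).ne_zero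
  have : (volume : Measure (Ep p × Ep p)).IsAddHaarMeasure :=
    inferInstanceAs ((volume : Measure (Ep p)).prod volume).IsAddHaarMeasure
  have h := Measure.map_linearMap_addHaar_eq_smul_addHaar
    (volume : Measure (Ep p × Ep p)) hdet
  refine ⟨_, ?_, ENNReal.ofReal_ne_top, h⟩
  simpa using hdet

lemma exists_map_withDensity_postDens (p : ℕ) {s t : ℝ} (hs : 0 < s) (ht : 0 < t)
    (x1 x2 : Ep p) {A : Set (Ep p)} (hA : MeasurableSet A) :
    ∃ c : ℝ≥0∞, c ≠ 0 ∧ c ≠ ∞ ∧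
      ((volume : Measure (Ep p × Ep p)).withDensity (postDens p s t x1 x2 A)).map
        (fun θ => (θ.1 - θ.2, (t / s) • θ.1 + θ.2)) =
      c • ((gaussMeasure p (s + t) (x1 - x2)).restrict A).prod
        (gaussMeasure p ((1 + t / s) * t) ((t / s) • x1 + x2)) := by
  have hr : 1 + t / s ≠ 0 := by positivity
  have hst : 0 < s + t := by positivity
  have htt : 0 < (1 + t / s) * t := by positivity
  obtain ⟨K, hK, hKeq⟩ := exists_gdens_mul_gdens_eq p hs ht
  obtain ⟨c, hc0, hctop, hc⟩ := exists_map_diffComb_volume p hr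
  set f1 : Ep p → ℝ≥0∞ := A.indicator
    (fun w => ENNReal.ofReal (gdens p (s + t) (w - (x1 - x2)))) with hf1
  set f2 : Ep p → ℝ≥0∞ := fun w =>
    ENNReal.ofReal (gdens p ((1 + t / s) * t) (w - ((t / s) • x1 + x2))) with hf2
  have hf1m : Measurable f1 := (measurable_ofReal_gdens_sub p _ _).indicator hA
  have hf2m : Measurable f2 := measurable_ofReal_gdens_sub p _ _
  have hf12m : Measurable (fun z : Ep p × Ep p => f1 z.1 * f2 z.2) := by fun_prop
  have hdens : postDens p s t x1 x2 A = fun θ => (ENNReal.ofReal K • fun z : Ep p × Ep p =>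
      f1 z.1 * f2 z.2) (θ.1 - θ.2, (t / s) • θ.1 + θ.2) := by
    funext θ
    simp only [postDens, Pi.smul_apply, smul_eq_mul, hf1, hf2]
    by_cases h : θ.1 - θ.2 ∈ A
    · rw [indicator_of_mem h, indicator_of_mem h, mul_one, hKeq, ENNReal.ofReal_mul hK.le,
        ENNReal.ofReal_mul (gdens_pos p hst _).le, sub_sub_sub_comm, smul_sub,
        sub_add_sub_comm]
    · simp [indicator_of_notMem h]
  refine ⟨ENNReal.ofReal K * c, mul_ne_zero (by simpa using hK) hc0,
    ENNReal.mul_ne_top ENNReal.ofReal_ne_top hctop, ?_⟩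
  rw [hdens, map_withDensity_comp (by fun_prop) (hf12m.const_smul _), hc,
    withDensity_smul _ hf12m, withDensity_smul_measure, smul_smul, gaussMeasure, gaussMeasure,
    restrict_withDensity hA, ← withDensity_indicator hA, Measure.volume_eq_prod,
    prod_withDensity hf1m hf2m]

/-- Posterior decomposition under the uniform prior restricted to `A`:
`ω1 = θ1 - θ2` and `ω2 = rθ1 + θ2` are independent, `ω2 ~ N_p(rx1+x2, (1+r)σ2² I)`,
`ω1 ~ N_p(x1-x2, (σ1²+σ2²) I)` conditioned to `A`, and
`E(θ1) = (E(ω1) + rx1 + x2)/(1+r)`. -/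
theorem stmt14 (p : ℕ) (σ12 σ22 : ℝ) (hσ1 : 0 < σ12) (hσ2 : 0 < σ22)
    (x1 x2 : Ep p) (r : ℝ) (hr : r = σ22 / σ12)
    (A : Set (Ep p)) (hA : MeasurableSet A)
    (ν1 : Measure (Ep p))
    (hν1 : ν1 = (volume : Measure (Ep p)).withDensity
      (fun w => ENNReal.ofReal (gdens p (σ12 + σ22) (w - (x1 - x2)))))
    (hApos : 0 < ν1 A)
    (μpost : Measure (Ep p × Ep p))
    (hμpost : μpost =
      (((volume : Measure (Ep p × Ep p)).withDensity (postDens p σ12 σ22 x1 x2 A))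
          Set.univ)⁻¹ •
        ((volume : Measure (Ep p × Ep p)).withDensity (postDens p σ12 σ22 x1 x2 A))) :
    (Measure.map (fun θ : Ep p × Ep p => (θ.1 - θ.2, r • θ.1 + θ.2)) μpost =
      ((ν1 A)⁻¹ • ν1.restrict A).prod
        ((volume : Measure (Ep p)).withDensity
          (fun w => ENNReal.ofReal (gdens p ((1 + r) * σ22) (w - (r • x1 + x2)))))) ∧
    ((∫ θ : Ep p × Ep p, θ.1 ∂μpost) =
      (1 + r)⁻¹ • ((∫ ω : Ep p, ω ∂((ν1 A)⁻¹ • ν1.restrict A)) + r • x1 + x2)) := by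
  have hr0 : 0 < r := hr ▸ div_pos hσ2 hσ1
  have hr1 : 1 + r ≠ 0 := by positivity
  change ν1 = gaussMeasure p _ _ at hν1
  set ν2 : Measure (Ep p) := (volume : Measure (Ep p)).withDensity
    (fun w => ENNReal.ofReal (gdens p ((1 + r) * σ22) (w - (r • x1 + x2)))) with hν2
  change ν2 = gaussMeasure p _ _ at hν2
  have hv2 : 0 < (1 + r) * σ22 := by positivity
  have : IsProbabilityMeasure ν1 :=
    hν1 ▸ isProbabilityMeasure_gaussMeasure p (add_pos hσ1 hσ2) _
  have : IsProbabilityMeasure ν2 := hν2 ▸ isProbabilityMeasure_gaussMeasure p hv2 _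
  have hT : Measurable (fun θ : Ep p × Ep p => (θ.1 - θ.2, r • θ.1 + θ.2)) := by fun_prop
  obtain ⟨c, hc0, hctop, hc⟩ := exists_map_withDensity_postDens p hσ1 hσ2 x1 x2 hA
  rw [← hr, ← hν1, ← hν2] at hc
  have hmass : (volume : Measure (Ep p × Ep p)).withDensity (postDens p σ12 σ22 x1 x2 A) univ =
      c * ν1 A := by
    have h := DFunLike.congr_fun hc univ
    rw [Measure.map_apply hT MeasurableSet.univ, preimage_univ, Measure.smul_apply,
      ← univ_prod_univ (α := Ep p), Measure.prod_prod, measure_univ (μ := ν2), mul_one,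
      Measure.restrict_apply_univ, smul_eq_mul, univ_prod_univ] at h
    exact h
  have hmap : Measure.map (fun θ : Ep p × Ep p => (θ.1 - θ.2, r • θ.1 + θ.2)) μpost =
      ((ν1 A)⁻¹ • ν1.restrict A).prod ν2 := by
    rw [hμpost, Measure.map_smul, hc, hmass, smul_smul, Measure.prod_smul_left,
      ENNReal.mul_inv (Or.inl hc0) (Or.inl hctop), mul_right_comm, ENNReal.inv_mul_cancel hc0 hctop,
      one_mul]
  refine ⟨hmap, ?_⟩
  have hA' : (ν1 A)⁻¹ ≠ ∞ := ENNReal.inv_ne_top.mpr hApos.ne'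
  have : IsProbabilityMeasure ((ν1 A)⁻¹ • ν1.restrict A) :=
    ⟨by simp [ENNReal.inv_mul_cancel hApos.ne' (measure_ne_top ν1 A)]⟩
  have hi1 : Integrable (fun w => w) ((ν1 A)⁻¹ • ν1.restrict A) :=
    ((hν1 ▸ integrable_id_gaussMeasure p (add_pos hσ1 hσ2) _ :
      Integrable (fun w => w) ν1).restrict).smul_measure hA'
  have hi2 : Integrable (fun w => w) ν2 := hν2 ▸ integrable_id_gaussMeasure p hv2 _
  have hm2 : ∫ w, w ∂ν2 = r • x1 + x2 := hν2 ▸ integral_id_gaussMeasure p hv2 _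
  have hinv : ∀ θ : Ep p × Ep p, θ.1 =
      (1 + r)⁻¹ • ((θ.1 - θ.2) + (r • θ.1 + θ.2)) := by
    intro θ
    rw [eq_inv_smul_iff₀ hr1]
    module
  calc ∫ θ, θ.1 ∂μpost
      = ∫ θ : Ep p × Ep p, (1 + r)⁻¹ • ((θ.1 - θ.2) + (r • θ.1 + θ.2)) ∂μpost :=
        integral_congr_ae (ae_of_all _ hinv)
    _ = ∫ ω : Ep p × Ep p, (1 + r)⁻¹ • (ω.1 + ω.2)
          ∂(((ν1 A)⁻¹ • ν1.restrict A).prod ν2) := by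
        rw [← hmap, integral_map hT.aemeasurable
          (Continuous.aestronglyMeasurable (by fun_prop))]
    _ = _ := by
        rw [integral_smul, integral_add (hi1.comp_fst ν2) (hi2.comp_snd _),
          integral_fun_fst (fun w : Ep p => w), integral_fun_snd (fun w : Ep p => w), hm2,
          probReal_univ, probReal_univ, one_smul, one_smul, add_assoc]

end
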